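/- Let (S, 𝒜, μ) be a σ-finite measure space, let 1 < p < ∞, and let X be a strongly convex real Banach space. Then the Lebesgue–Bochner space L^p(μ, X) is strongly convex. -/

import Mathlib

open scoped ENNReal
open Filter MeasureTheory

/-- A Banach space `X` is strongly convex if whenever `(xₙ)` is a sequence in the unit sphere,
`x` is in the unit sphere, and there is a functional `x*` in the unit sphere of the dual with
`x*(x) = 1` and `x*(xₙ) → 1`, then `‖xₙ − x‖ → 0`. -/
def StronglyConvexSpace (X : Type*) [NormedAddCommGroup X] [NormedSpace ℝ X] : Prop :=
  ∀ (xs : ℕ → X), (∀ n, ‖xs n‖ = 1) → ∀ (x : X), ‖x‖ = 1 →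
    ∀ (φ : X →L[ℝ] ℝ), ‖φ‖ = 1 → φ x = 1 →
    Tendsto (fun n => φ (xs n)) atTop (nhds 1) →
    Tendsto (fun n => ‖xs n - x‖) atTop (nhds 0)


theorem StronglyConvexSpace.tendsto_of_norm_le {X : Type*} [NormedAddCommGroup X] [NormedSpace ℝ X]
    (hX : StronglyConvexSpace X) {x : X} (hx : x ≠ 0) {xs : ℕ → X} {φ : X →L[ℝ] ℝ}
    (hφ : ‖φ‖ ≤ 1) (hφx : φ x = ‖x‖) (hnorm : Tendsto (fun n => ‖xs n‖) atTop (nhds ‖x‖))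
    (hφxs : Tendsto (fun n => φ (xs n)) atTop (nhds ‖x‖)) :
    Tendsto xs atTop (nhds x) := by
  classical
  have hx0 : ‖x‖ ≠ 0 := norm_ne_zero_iff.2 hx
  have hφ1 : ‖φ‖ = 1 := by
    refine le_antisymm hφ ?_
    have := φ.le_opNorm x
    rw [hφx, norm_norm] at this
    exact le_of_mul_le_mul_right (by simpa using this) (norm_pos_iff.2 hx)
  have hev : ∀ᶠ n in atTop, xs n ≠ 0 := by
    filter_upwards [hnorm.eventually_ne hx0] with n hn using norm_ne_zero_iff.1 hn
  set ys : ℕ → X := fun n => if xs n = 0 then ‖x‖⁻¹ • x else ‖xs n‖⁻¹ • xs n with hys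
  have hysev : ∀ᶠ n in atTop, ys n = ‖xs n‖⁻¹ • xs n := by
    filter_upwards [hev] with n hn
    simp [hys, hn]
  have key : Tendsto (fun n => ‖ys n - ‖x‖⁻¹ • x‖) atTop (nhds 0) := by
    refine hX ys (fun n => ?_) _ (norm_smul_inv_norm hx) φ hφ1 (by simp [hφx, hx0]) ?_
    · by_cases h : xs n = 0
      · simp only [hys, h, if_true]
        exact norm_smul_inv_norm hx
      · simp only [hys, h, if_false]
        exact norm_smul_inv_norm h
    · have h := (hnorm.inv₀ hx0).mul hφxs
      rw [inv_mul_cancel₀ hx0] at h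
      refine h.congr' ?_
      filter_upwards [hysev] with n hn
      simp [hn]
  have h := hnorm.smul (tendsto_iff_norm_sub_tendsto_zero.2 key)
  rw [smul_inv_smul₀ hx0] at h
  refine h.congr' ?_
  filter_upwards [hysev, hev] with n hn hn0
  rw [hn, smul_inv_smul₀ (norm_ne_zero_iff.2 hn0)]

theorem exists_continuousLinearMap_of_sum_le {ι X : Type*} [NormedAddCommGroup X] [NormedSpace ℝ X]
    (x : ι → X) (g : ι → ℝ) {w : ℝ} (hw : 0 ≤ w)
    (h : ∀ c : ι →₀ ℝ, (c.sum fun i a => a * g i) ≤ w * ‖c.sum fun i a => a • x i‖) :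
    ∃ φ : X →L[ℝ] ℝ, ‖φ‖ ≤ w ∧ ∀ i, φ (x i) = g i := by
  set T : (ι →₀ ℝ) →ₗ[ℝ] X := Finsupp.linearCombination ℝ x
  set L : (ι →₀ ℝ) →ₗ[ℝ] ℝ := Finsupp.linearCombination ℝ g
  have hLT : ∀ c, L c ≤ w * ‖T c‖ := fun c => by
    simpa [T, L, Finsupp.linearCombination_apply] using h c
  have hker : ∀ c, T c = 0 → L c = 0 := fun c hc => by
    have h1 := hLT c
    have h2 := hLT (-c)
    simp only [map_neg, hc, norm_neg, norm_zero, mul_zero] at h1 h2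
    linarith
  obtain ⟨s, hs⟩ := T.rangeRestrict.exists_rightInverse_of_surjective T.range_rangeRestrict
  have hTs : ∀ y, T (s y) = y := fun y => congrArg Subtype.val (LinearMap.congr_fun hs y)
  let ℓ : StrongDual ℝ (LinearMap.range T) := (L ∘ₗ s).mkContinuous w fun y => by
    rw [Real.norm_eq_abs, abs_le]
    have h1 := hLT (s y)
    have h2 := hLT (-s y)
    simp only [map_neg, norm_neg, hTs] at h1 h2
    exact ⟨by simpa using neg_le.1 h2, by simpa using h1⟩
  obtain ⟨φ, hφ, hnorm⟩ := exists_extension_norm_eq (LinearMap.range T) ℓ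
  refine ⟨φ, hnorm.trans_le (LinearMap.mkContinuous_norm_le _ hw _), fun i => ?_⟩
  have hxi : T (Finsupp.single i 1) = x i := by simp [T]
  have hgi : L (Finsupp.single i 1) = g i := by simp [L]
  have := hφ (T.rangeRestrict (Finsupp.single i 1))
  rw [show ((T.rangeRestrict (Finsupp.single i 1) : LinearMap.range T) : X) = x i from hxi] at this
  rw [this, ← hgi]
  change L (s _) = _
  rw [← sub_eq_zero, ← map_sub]
  apply hker
  rw [map_sub, hTs]
  simp

theorem sum_le_of_forall_rat_sum_le {ι X : Type*} [Fintype ι] [NormedAddCommGroup X]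
    [NormedSpace ℝ X] (x : ι → X) (g : ι → ℝ) (w : ℝ)
    (h : ∀ c : ι → ℚ, ∑ i, (c i : ℝ) * g i ≤ w * ‖∑ i, (c i : ℝ) • x i‖) (c : ι → ℝ) :
    ∑ i, c i * g i ≤ w * ‖∑ i, c i • x i‖ := by
  have hd : DenseRange (Pi.map fun (_ : ι) (q : ℚ) => (q : ℝ)) :=
    DenseRange.piMap fun _ => Rat.isDenseEmbedding_coe_real.dense
  have hc : IsClosed {c : ι → ℝ | ∑ i, c i * g i ≤ w * ‖∑ i, c i • x i‖} :=
    isClosed_le (by fun_prop) (by fun_prop)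
  exact hd.induction_on c hc fun q => h q

theorem mul_rpow_sub_one_mul_le {r : ℝ} (hr : 1 < r) {a b : ℝ} (ha : 0 ≤ a) (hb : 0 ≤ b) :
    r * (a ^ (r - 1) * b) ≤ b ^ r + (r - 1) * a ^ r := by
  have hq := Real.HolderConjugate.conjExponent hr
  have h := Real.young_inequality_of_nonneg hb (Real.rpow_nonneg ha (r - 1)) hq
  rw [← Real.rpow_mul ha, Real.conjExponent, mul_div_cancel₀ _ (by linarith : r - 1 ≠ 0)] at h
  have h0 : 0 < r := by linarith
  have h1 : 0 < r - 1 := by linarith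
  field_simp at h
  linarith

theorem tendsto_of_young_defect_tendsto_zero {r : ℝ} (hr : 1 < r) {a : ℝ} (ha : 0 ≤ a) {b : ℕ → ℝ}
    (hb : ∀ n, 0 ≤ b n)
    (h : Tendsto (fun n => b n ^ r + (r - 1) * a ^ r - r * (a ^ (r - 1) * b n)) atTop (nhds 0)) :
    Tendsto b atTop (nhds a) := by
  set D : ℝ → ℝ := fun t => t ^ r + ((r - 1) * a ^ r - r * (a ^ (r - 1) * t)) with hD
  have hDb : Tendsto (fun n => D (b n)) atTop (nhds 0) := h.congr fun n => by simp only [hD]; ring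
  have hconv : StrictConvexOn ℝ (Set.Ici 0) D := by
    refine (strictConvexOn_rpow hr).add_convexOn ⟨convex_Ici 0, ?_⟩
    intro x _ y _ s t _ _ hst
    have : s = 1 - t := by linarith
    subst this
    simp only [smul_eq_mul]
    exact le_of_eq (by ring)
  have hDa : D a = 0 := by
    have : a ^ r = a ^ (r - 1) * a := by
      rw [← Real.rpow_add_one' ha (by linarith), sub_add_cancel]
    simp only [hD, this]
    ring
  have hnonneg : ∀ t, 0 ≤ t → 0 ≤ D t := fun t ht => by
    have := mul_rpow_sub_one_mul_le hr ha ht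
    simp only [hD]
    linarith
  have hpos : ∀ t, 0 ≤ t → t ≠ a → 0 < D t := fun t ht hta => by
    refine (hnonneg t ht).lt_of_ne' fun h0 => ?_
    have := hconv.2 ht (Set.mem_Ici.2 ha) hta (half_pos one_pos) (half_pos one_pos)
      (add_halves 1)
    rw [h0, hDa] at this
    have h2 := hnonneg ((1 / 2 : ℝ) • t + (1 / 2 : ℝ) • a) (by simp only [smul_eq_mul]; positivity)
    simp only [smul_eq_mul, mul_zero, add_zero] at this h2
    linarith
  rw [tendsto_order]
  have hsep : ∀ t, 0 ≤ t → t ≠ a → ∀ᶠ n in atTop, t ∉ segment ℝ a (b n) := fun t ht hta => by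
    filter_upwards [hDb.eventually_lt_const (hpos t ht hta)] with n hn hmem
    have := hconv.convexOn.le_max_of_mem_segment (Set.mem_Ici.2 ha) (Set.mem_Ici.2 (hb n)) hmem
    rw [hDa, max_eq_right (hnonneg _ (hb n))] at this
    linarith
  refine ⟨fun t ht => ?_, fun t ht => ?_⟩
  · rcases lt_or_ge t 0 with h0 | h0
    · exact Eventually.of_forall fun n => h0.trans_le (hb n)
    · filter_upwards [hsep t h0 ht.ne] with n hn
      by_contra! hle
      exact hn (by rw [segment_symm, segment_eq_Icc (hle.trans ht.le)]; exact ⟨hle, ht.le⟩)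
  · filter_upwards [hsep t (ha.trans ht.le) ht.ne'] with n hn
    by_contra! hle
    exact hn (by rw [segment_eq_Icc (ht.le.trans hle)]; exact ⟨ht.le, hle⟩)

theorem tendsto_integral_zero_of_le_of_tendsto_ae {S : Type*} [MeasurableSpace S] {μ : Measure S}
    {u v : ℕ → S → ℝ} {V : S → ℝ} (hu : ∀ n, Integrable (u n) μ) (hv : ∀ n, Integrable (v n) μ)
    (hV : Integrable V μ) (hu0 : ∀ n s, 0 ≤ u n s) (huv : ∀ n s, u n s ≤ v n s)
    (hV0 : ∀ s, 0 ≤ V s) (hulim : ∀ᵐ s ∂μ, Tendsto (fun n => u n s) atTop (nhds 0))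
    (hvlim : ∀ᵐ s ∂μ, Tendsto (fun n => v n s) atTop (nhds (V s)))
    (hint : Tendsto (fun n => ∫ s, v n s ∂μ) atTop (nhds (∫ s, V s ∂μ))) :
    Tendsto (fun n => ∫ s, u n s ∂μ) atTop (nhds 0) := by
  have hi1 : ∀ n, Integrable (fun s => min (u n s) (V s)) μ := fun n => (hu n).inf hV
  have hi2 : ∀ n, Integrable (fun s => max (V s - v n s) 0) μ := fun n => (hV.sub (hv n)).pos_part
  have h1 : Tendsto (fun n => ∫ s, min (u n s) (V s) ∂μ) atTop (nhds (∫ _, (0 : ℝ) ∂μ)) := by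
    refine tendsto_integral_of_dominated_convergence V (fun n => (hi1 n).1) hV
      (fun n => ae_of_all _ fun s => ?_) ?_
    · rw [Real.norm_of_nonneg (le_min (hu0 n s) (hV0 s))]
      exact min_le_right _ _
    · filter_upwards [hulim] with s hs
      simpa [hV0 s] using hs.min (tendsto_const_nhds (x := V s))
  have h2 : Tendsto (fun n => ∫ s, max (V s - v n s) 0 ∂μ) atTop (nhds (∫ _, (0 : ℝ) ∂μ)) := by
    refine tendsto_integral_of_dominated_convergence V (fun n => (hi2 n).1) hV
      (fun n => ae_of_all _ fun s => ?_) ?_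
    · rw [Real.norm_of_nonneg (le_max_right _ _)]
      exact max_le (by linarith [hu0 n s, huv n s]) (hV0 s)
    · filter_upwards [hvlim] with s hs
      simpa using (hs.const_sub (V s)).max (tendsto_const_nhds (x := (0 : ℝ)))
  rw [integral_zero] at h1 h2
  have h3 := (h1.add (hint.sub_const (∫ s, V s ∂μ))).add h2
  rw [sub_self, add_zero, add_zero] at h3
  refine squeeze_zero (fun n => integral_nonneg (hu0 n)) (fun n => ?_) h3
  rw [← integral_sub' (hv n) hV, ← integral_add' (hi1 n) ((hv n).sub hV),
    ← integral_add' ((hi1 n).add ((hv n).sub hV)) (hi2 n)]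
  refine integral_mono (hu n) (((hi1 n).add ((hv n).sub hV)).add (hi2 n)) fun s => ?_
  have := huv n s
  simp only [Pi.add_apply, Pi.sub_apply]
  rcases le_total (u n s) (V s) with h | h
  · rw [min_eq_left h]
    linarith [le_max_left (V s - v n s) 0]
  · rw [min_eq_right h]
    linarith [le_max_right (V s - v n s) 0]

section Lp

variable {S : Type*} [MeasurableSpace S] {μ : Measure S} {p : ℝ≥0∞}
  {X : Type*} [NormedAddCommGroup X]

theorem MeasureTheory.MemLp.integrable_norm_rpow_sub_one_mul_norm {Y : Type*}
    [NormedAddCommGroup Y] (hp : 1 < p) (hp' : p ≠ ⊤) {u : S → X} {v : S → Y} (hu : MemLp u p μ)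
    (hv : MemLp v p μ) : Integrable (fun s => ‖u s‖ ^ (p.toReal - 1) * ‖v s‖) μ := by
  have hr : 1 < p.toReal := (ENNReal.toReal_lt_toReal ENNReal.one_ne_top hp').2 hp
  have hp0 : p ≠ 0 := (zero_lt_one.trans hp).ne'
  refine ((hv.integrable_norm_rpow hp0 hp').add
    ((hu.integrable_norm_rpow hp0 hp').const_mul (p.toReal - 1))).mono'
    ((hu.1.norm.aemeasurable.pow_const _).mul hv.1.norm.aemeasurable).aestronglyMeasurable
    (ae_of_all _ fun s => ?_)
  have h := mul_rpow_sub_one_mul_le hr (norm_nonneg (u s)) (norm_nonneg (v s))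
  have h0 : 0 ≤ ‖u s‖ ^ (p.toReal - 1) * ‖v s‖ := by positivity
  rw [Real.norm_of_nonneg h0]
  simp only [Pi.add_apply]
  nlinarith

theorem MeasureTheory.Lp.norm_rpow_eq_integral (hp : p ≠ 0) (hp' : p ≠ ⊤) (f : Lp X p μ) :
    ‖f‖ ^ p.toReal = ∫ s, ‖f s‖ ^ p.toReal ∂μ := by
  have h0 : 0 ≤ ∫ s, ‖f s‖ ^ p.toReal ∂μ := integral_nonneg fun s => by positivity
  rw [Lp.norm_def, (Lp.memLp f).eLpNorm_eq_integral_rpow_norm hp hp',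
    ENNReal.toReal_ofReal (by positivity), Real.rpow_inv_rpow h0 (ENNReal.toReal_pos hp hp').ne']

variable [NormedSpace ℝ X]

/-- Multiplication by the indicator function of a measurable set, as a linear map on `L^p`. -/
noncomputable def MeasureTheory.Lp.indicatorₗ {A : Set S} (hA : MeasurableSet A) :
    Lp X p μ →ₗ[ℝ] Lp X p μ where
  toFun f := ((Lp.memLp f).indicator hA).toLp _
  map_add' f g := by
    rw [← MemLp.toLp_add]
    refine MemLp.toLp_congr _ _ ?_
    filter_upwards [Lp.coeFn_add f g] with s hs
    rw [← Set.indicator_add']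
    by_cases h : s ∈ A
    · rw [Set.indicator_of_mem h, Set.indicator_of_mem h, hs]
    · rw [Set.indicator_of_notMem h, Set.indicator_of_notMem h]
  map_smul' c f := by
    rw [RingHom.id_apply, ← MemLp.toLp_const_smul]
    refine MemLp.toLp_congr _ _ ?_
    filter_upwards [Lp.coeFn_smul c f] with s hs
    rw [Pi.smul_apply]
    by_cases h : s ∈ A
    · rw [Set.indicator_of_mem h, Set.indicator_of_mem h, hs, Pi.smul_apply]
    · rw [Set.indicator_of_notMem h, Set.indicator_of_notMem h, smul_zero]

theorem MeasureTheory.Lp.coeFn_indicatorₗ {A : Set S} (hA : MeasurableSet A) (f : Lp X p μ) :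
    Lp.indicatorₗ hA f =ᵐ[μ] A.indicator f := by
  have h : Lp.indicatorₗ hA f = ((Lp.memLp f).indicator hA).toLp _ := rfl
  rw [h]
  exact MemLp.coeFn_toLp _

theorem MeasureTheory.Lp.indicatorₗ_union {A B : Set S} (hA : MeasurableSet A)
    (hB : MeasurableSet B) (hAB : Disjoint A B) (f : Lp X p μ) :
    Lp.indicatorₗ (hA.union hB) f = Lp.indicatorₗ hA f + Lp.indicatorₗ hB f := by
  refine Lp.ext ?_
  filter_upwards [Lp.coeFn_indicatorₗ (hA.union hB) f, Lp.coeFn_indicatorₗ hA f,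
    Lp.coeFn_indicatorₗ hB f, Lp.coeFn_add (Lp.indicatorₗ hA f) (Lp.indicatorₗ hB f)]
    with s h1 h2 h3 h4
  rw [h1, h4, Pi.add_apply, h2, h3, Set.indicator_union_of_disjoint hAB]

theorem MeasureTheory.Lp.indicatorₗ_univ (f : Lp X p μ) :
    Lp.indicatorₗ MeasurableSet.univ f = f := by
  refine Lp.ext ((Lp.coeFn_indicatorₗ _ f).trans ?_)
  rw [Set.indicator_univ]

variable [Fact (1 ≤ p)]

/-- A functional of norm at most one attaining its norm at the unit vector `f` is dominated by
the derivative of the `L^p` norm of scalar functions at `‖f ·‖`. -/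
theorem MeasureTheory.Lp.apply_le_integral_of_norming (hp : 1 < p) (hp' : p ≠ ⊤)
    {Φ : Lp X p μ →L[ℝ] ℝ} (hΦ : ‖Φ‖ ≤ 1) {f : Lp X p μ} (hf : ‖f‖ = 1) (hΦf : Φ f = 1)
    (h : Lp X p μ) : Φ h ≤ ∫ s, ‖f s‖ ^ (p.toReal - 1) * ‖h s‖ ∂μ := by
  have hr : 1 < p.toReal := (ENNReal.toReal_lt_toReal ENNReal.one_ne_top hp').2 hp
  have hp0 : p ≠ 0 := (zero_lt_one.trans hp).ne'
  set r := p.toReal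
  have hmem : ∀ t : ℝ, MemLp (fun s => ‖f s‖ + t * ‖h s‖) p μ := fun t =>
    (Lp.memLp f).norm.add ((Lp.memLp h).norm.const_mul t)
  have hint : ∀ t : ℝ, 0 ≤ t →
      Integrable (fun s => (‖f s‖ + t * ‖h s‖) ^ (r - 1) * ‖h s‖) μ := fun t ht => by
    refine ((hmem t).integrable_norm_rpow_sub_one_mul_norm hp hp' (Lp.memLp h)).congr
      (ae_of_all _ fun s => ?_)
    simp only [Real.norm_of_nonneg (show 0 ≤ ‖f s‖ + t * ‖h s‖ by positivity)]
    rfl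
  have hbound : ∀ t : ℝ, 0 < t → -1 ≤ t * Φ h →
      Φ h ≤ ∫ s, (‖f s‖ + t * ‖h s‖) ^ (r - 1) * ‖h s‖ ∂μ := fun t ht hth => by
    have hle : 1 + t * Φ h ≤ ‖f + t • h‖ := by
      have := (le_abs_self _).trans (Φ.le_of_opNorm_le hΦ (f + t • h))
      simpa [hΦf] using this
    have hle' : (1 + t * Φ h) ^ r ≤ ‖f + t • h‖ ^ r :=
      Real.rpow_le_rpow (by linarith) hle (by linarith)
    have hbern := one_add_mul_self_le_rpow_one_add hth hr.le
    have hf1 := Lp.norm_rpow_eq_integral hp0 hp' f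
    rw [hf, Real.one_rpow] at hf1
    rw [Lp.norm_rpow_eq_integral hp0 hp'] at hle'
    have hfi := (Lp.memLp f).integrable_norm_rpow hp0 hp'
    have hmono : ∫ s, ‖(f + t • h : Lp X p μ) s‖ ^ r ∂μ ≤
        ∫ s, (‖f s‖ ^ r + r * t * ((‖f s‖ + t * ‖h s‖) ^ (r - 1) * ‖h s‖)) ∂μ := by
      refine integral_mono_ae ((Lp.memLp _).integrable_norm_rpow hp0 hp')
        (hfi.add ((hint t ht.le).const_mul _)) ?_
      filter_upwards [Lp.coeFn_add f (t • h), Lp.coeFn_smul t h] with s hs1 hs2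
      rw [hs1, Pi.add_apply, hs2, Pi.smul_apply]
      have h1 : ‖f s + t • h s‖ ≤ ‖f s‖ + t * ‖h s‖ := by
        simpa [norm_smul, abs_of_pos ht] using norm_add_le (f s) (t • h s)
      have hy0 : 0 ≤ ‖f s‖ + t * ‖h s‖ := by positivity
      refine (Real.rpow_le_rpow (norm_nonneg _) h1 (by linarith)).trans ?_
      have h2 := mul_rpow_sub_one_mul_le hr hy0 (norm_nonneg (f s))
      have h3 : (‖f s‖ + t * ‖h s‖) ^ r =
          (‖f s‖ + t * ‖h s‖) ^ (r - 1) * (‖f s‖ + t * ‖h s‖) := by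
        rw [← Real.rpow_add_one' hy0 (by linarith), sub_add_cancel]
      have h4 : r * (‖f s‖ + t * ‖h s‖) ^ r = r * ((‖f s‖ + t * ‖h s‖) ^ (r - 1) * ‖f s‖) +
          r * t * ((‖f s‖ + t * ‖h s‖) ^ (r - 1) * ‖h s‖) := by
        rw [h3]
        ring
      change _ ≤ ‖f s‖ ^ r + r * t * ((‖f s‖ + t * ‖h s‖) ^ (r - 1) * ‖h s‖)
      linarith
    rw [integral_add hfi ((hint t ht.le).const_mul _), integral_const_mul] at hmono
    have hrt : 0 < r * t := by positivity
    refine le_of_mul_le_mul_left ?_ hrt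
    linarith
  have hpos : ∀ n : ℕ, 0 < ((n : ℝ) + 1)⁻¹ := fun n => by positivity
  have hlim0 : Tendsto (fun n : ℕ => ((n : ℝ) + 1)⁻¹) atTop (nhds 0) := by
    simpa using tendsto_one_div_add_atTop_nhds_zero_nat (𝕜 := ℝ)
  have hlim : Tendsto (fun n : ℕ => ∫ s, (‖f s‖ + ((n : ℝ) + 1)⁻¹ * ‖h s‖) ^ (r - 1) * ‖h s‖ ∂μ)
      atTop (nhds (∫ s, ‖f s‖ ^ (r - 1) * ‖h s‖ ∂μ)) := by
    refine tendsto_integral_of_dominated_convergence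
      (fun s => (‖f s‖ + 1 * ‖h s‖) ^ (r - 1) * ‖h s‖) (fun n => (hint _ (hpos n).le).1)
      (hint 1 zero_le_one) (fun n => ae_of_all _ fun s => ?_) (ae_of_all _ fun s => ?_)
    · have : ((n : ℝ) + 1)⁻¹ ≤ 1 := inv_le_one_of_one_le₀ (by linarith [n.cast_nonneg (α := ℝ)])
      have := hpos n
      rw [Real.norm_of_nonneg (by positivity)]
      gcongr
    · refine Tendsto.mul_const _ (Tendsto.rpow_const ?_ (Or.inr (by linarith)))
      simpa using (hlim0.mul_const ‖h s‖).const_add ‖f s‖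
  refine ge_of_tendsto hlim ?_
  have hlim1 := hlim0.mul_const (Φ h)
  rw [zero_mul] at hlim1
  filter_upwards [hlim1.eventually_const_le (show (-1 : ℝ) < 0 by norm_num)] with n hn
    using hbound _ (hpos n) hn

end Lp

/-- A finitely additive set function dominated by an indefinite integral has a density. -/
theorem exists_density_of_abs_le_setIntegral {S : Type*} [MeasurableSpace S] {μ : Measure S}
    [SigmaFinite μ] {m : Set S → ℝ} {w : S → ℝ} (hw : Integrable w μ)
    (hm : ∀ A B, MeasurableSet A → MeasurableSet B → Disjoint A B → m (A ∪ B) = m A + m B)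
    (hmw : ∀ A, MeasurableSet A → |m A| ≤ ∫ s in A, w s ∂μ) :
    ∃ g : S → ℝ, Integrable g μ ∧ ∀ A, MeasurableSet A → m A = ∫ s in A, g s ∂μ := by
  classical
  have hm0 : m ∅ = 0 := by simpa using hmw ∅ MeasurableSet.empty
  have hsum : ∀ (A : ℕ → Set S), (∀ i, MeasurableSet (A i)) → Pairwise (Function.onFun Disjoint A) →
      ∀ t : Finset ℕ, m (⋃ i ∈ t, A i) = ∑ i ∈ t, m (A i) := fun A hA hd t => by
    induction t using Finset.induction_on with
    | empty => simpa using hm0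
    | insert i t hi ih =>
      rw [Finset.set_biUnion_insert, hm _ _ (hA i) (t.measurableSet_biUnion fun j _ => hA j),
        ih, Finset.sum_insert hi]
      exact Set.disjoint_iUnion₂_right.2 fun j hj => hd fun h => hi (h ▸ hj)
  let ν : SignedMeasure S :=
    { measureOf' := fun A => if MeasurableSet A then m A else 0
      empty' := by simp [hm0]
      not_measurable' := fun A hA => if_neg hA
      m_iUnion' := fun A hA hd => by
        simp only [hA, MeasurableSet.iUnion hA, if_true]
        have hw' := hasSum_integral_iUnion hA hd hw.integrableOn
        rw [HasSum, SummationFilter.unconditional_filter] at hw' ⊢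
        rw [tendsto_iff_norm_sub_tendsto_zero] at hw' ⊢
        refine squeeze_zero (fun _ => norm_nonneg _) (fun t => ?_) hw'
        have hT : MeasurableSet (⋃ i ∈ t, A i) := t.measurableSet_biUnion fun j _ => hA j
        have hsub : (⋃ i ∈ t, A i) ⊆ ⋃ i, A i := Set.iUnion₂_subset_iUnion _ _
        have hD := (MeasurableSet.iUnion hA).diff hT
        have h1 := hm _ _ hT hD Set.disjoint_sdiff_right
        rw [Set.union_sdiff_cancel hsub, hsum A hA hd] at h1
        have h2 := hmw _ hD
        rw [setIntegral_sdiff hT hw.integrableOn hsub,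
          integral_biUnion_finset t (fun i _ => hA i) (fun i _ j _ hij => hd hij)
            (fun i _ => hw.integrableOn)] at h2
        rw [Real.norm_eq_abs, Real.norm_eq_abs, abs_sub_comm, h1, add_sub_cancel_left, abs_sub_comm]
        exact h2.trans (le_abs_self _) }
  have hν : ∀ A, MeasurableSet A → ν A = m A := fun A hA => if_pos hA
  have hac : ν ≪ᵥ μ.toENNRealVectorMeasure := by
    refine VectorMeasure.AbsolutelyContinuous.mk fun A hA h0 => ?_
    rw [Measure.toENNRealVectorMeasure_apply_measurable hA] at h0
    rw [hν A hA, ← abs_eq_zero]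
    refine le_antisymm ((hmw A hA).trans_eq ?_) (abs_nonneg _)
    rw [Measure.restrict_eq_zero.2 h0, integral_zero_measure]
  refine ⟨ν.rnDeriv μ, ν.integrable_rnDeriv μ, fun A hA => ?_⟩
  rw [← withDensityᵥ_apply (ν.integrable_rnDeriv μ) hA, ν.withDensityᵥ_rnDeriv_eq μ hac, hν A hA]

/-- Along countably many elements of `L^p`, a functional attaining its norm at `f` is given by
integration against a field of functionals of norm at most `‖f ·‖ ^ (p - 1)`. -/
theorem MeasureTheory.Lp.exists_ae_continuousLinearMap_of_norming {S : Type*} [MeasurableSpace S]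
    {μ : Measure S} [SigmaFinite μ] {p : ℝ≥0∞} [Fact (1 ≤ p)] (hp : 1 < p) (hp' : p ≠ ⊤)
    {X : Type*} [NormedAddCommGroup X] [NormedSpace ℝ X] {Φ : Lp X p μ →L[ℝ] ℝ} (hΦ : ‖Φ‖ ≤ 1)
    {f : Lp X p μ} (hf : ‖f‖ = 1) (hΦf : Φ f = 1) {ι : Type*} [Countable ι] (F : ι → Lp X p μ) :
    ∃ g : ι → S → ℝ, (∀ i, Integrable (g i) μ) ∧ (∀ i, ∫ s, g i s ∂μ = Φ (F i)) ∧
      ∀ᵐ s ∂μ, ∃ φ : X →L[ℝ] ℝ, ‖φ‖ ≤ ‖f s‖ ^ (p.toReal - 1) ∧ ∀ i, φ (F i s) = g i s := by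
  classical
  have hint : ∀ h : Lp X p μ, Integrable (fun s => ‖f s‖ ^ (p.toReal - 1) * ‖h s‖) μ := fun h =>
    (Lp.memLp f).integrable_norm_rpow_sub_one_mul_norm hp hp' (Lp.memLp h)
  have hle : ∀ (h : Lp X p μ) (A : Set S) (hA : MeasurableSet A),
      Φ (Lp.indicatorₗ hA h) ≤ ∫ s in A, ‖f s‖ ^ (p.toReal - 1) * ‖h s‖ ∂μ := fun h A hA => by
    refine (Lp.apply_le_integral_of_norming hp hp' hΦ hf hΦf _).trans_eq ?_
    rw [← integral_indicator hA]
    refine integral_congr_ae ?_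
    filter_upwards [Lp.coeFn_indicatorₗ hA h] with s hs
    rw [hs]
    by_cases hsA : s ∈ A <;> simp [hsA]
  have hdens : ∀ i, ∃ g : S → ℝ, Integrable g μ ∧
      ∀ A (hA : MeasurableSet A), Φ (Lp.indicatorₗ hA (F i)) = ∫ s in A, g s ∂μ := fun i => by
    obtain ⟨g, hg, hgA⟩ := exists_density_of_abs_le_setIntegral
      (m := fun A => if hA : MeasurableSet A then Φ (Lp.indicatorₗ hA (F i)) else 0) (hint (F i))
      (fun A B hA hB hAB => by
        simp only [hA, hB, hA.union hB, dif_pos]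
        rw [Lp.indicatorₗ_union hA hB hAB, map_add])
      (fun A hA => by
        simp only [hA, dif_pos]
        refine abs_le.2 ⟨neg_le.1 ?_, hle (F i) A hA⟩
        rw [← map_neg, ← map_neg]
        refine (hle (-F i) A hA).trans_eq (setIntegral_congr_ae hA ?_)
        filter_upwards [Lp.coeFn_neg (F i)] with s hs _
        rw [hs, Pi.neg_apply, _root_.norm_neg])
    exact ⟨g, hg, fun A hA => by rw [← hgA A hA, dif_pos hA]⟩
  choose g hg hgA using hdens
  refine ⟨g, hg, fun i => ?_, ?_⟩
  · rw [← setIntegral_univ, ← hgA i _ MeasurableSet.univ, Lp.indicatorₗ_univ]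
  have hsum : ∀ᵐ s ∂μ, ∀ (t : Finset ι) (c : t → ℚ), ∑ i, (c i : ℝ) * g i s ≤
      ‖f s‖ ^ (p.toReal - 1) * ‖∑ i, (c i : ℝ) • F i s‖ := by
    rw [ae_all_iff]
    intro t
    rw [ae_all_iff]
    intro c
    set H : Lp X p μ := ∑ i, (c i : ℝ) • F i
    have hH : ∀ᵐ s ∂μ, H s = ∑ i, (c i : ℝ) • F i s := by
      have h1 : ∀ᵐ s ∂μ, ∀ i : t, ((c i : ℝ) • F i : Lp X p μ) s = (c i : ℝ) • F i s :=
        ae_all_iff.2 fun i => Lp.coeFn_smul (c i : ℝ) (F i)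
      filter_upwards [h1, Lp.coeFn_finsetSum Finset.univ fun i : t => (c i : ℝ) • F i]
        with s hs1 hs2
      rw [hs2, Finset.sum_apply]
      exact Finset.sum_congr rfl fun i _ => hs1 i
    have hle' : (fun s => ∑ i, (c i : ℝ) * g i s) ≤ᵐ[μ]
        fun s => ‖f s‖ ^ (p.toReal - 1) * ‖H s‖ := by
      refine ae_le_of_forall_setIntegral_le
        (integrable_finsetSum _ fun i _ => (hg i).const_mul _) (hint H) fun A hA _ => ?_
      rw [integral_finsetSum Finset.univ fun (i : t) _ =>
        ((hg i).const_mul (c i : ℝ)).integrableOn]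
      refine le_of_eq_of_le ?_ (hle H A hA)
      simp only [H, map_sum, map_smul, integral_const_mul, smul_eq_mul, hgA]
    filter_upwards [hle', hH] with s hs1 hs2
    rwa [← hs2]
  filter_upwards [hsum] with s hs
  refine exists_continuousLinearMap_of_sum_le (fun i => F i s) (fun i => g i s) (by positivity)
    fun c => ?_
  have := sum_le_of_forall_rat_sum_le (fun i : c.support => F i s) (fun i => g i s) _
    (hs c.support) (fun i => c i)
  rwa [Finset.sum_coe_sort c.support fun i => c i * g i s,
    Finset.sum_coe_sort c.support fun i => c i • F i s] at this

theorem exists_seq_tendsto_ae_of_tendsto_integral_zero {S : Type*} [MeasurableSpace S]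
    {μ : Measure S} {T : ℕ → S → ℝ} (hT : ∀ n, Integrable (T n) μ) (hT0 : ∀ n, 0 ≤ᵐ[μ] T n)
    (hlim : Tendsto (fun n => ∫ s, T n s ∂μ) atTop (nhds 0)) :
    ∃ ns : ℕ → ℕ, StrictMono ns ∧
      ∀ᵐ s ∂μ, Tendsto (fun n => T (ns n) s) atTop (nhds 0) := by
  refine (tendstoInMeasure_of_tendsto_eLpNorm (p := 1) (g := fun _ => (0 : ℝ)) one_ne_zero
    (fun n => (hT n).1) aestronglyMeasurable_const ?_).exists_seq_tendsto_ae
  have h := ENNReal.tendsto_ofReal hlim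
  rw [ENNReal.ofReal_zero] at h
  refine h.congr fun n => ?_
  have h1 : ∫ s, T n s ∂μ = ∫ s, ‖T n s‖ ∂μ := integral_congr_ae <| by
    filter_upwards [hT0 n] with s hs using (Real.norm_of_nonneg hs).symm
  rw [h1, ofReal_integral_norm_eq_lintegral_enorm (hT n), ← eLpNorm_one_eq_lintegral_enorm]
  congr 1
  ext s
  simp

theorem MeasureTheory.Lp.tendsto_norm_sub_zero_of_tendsto_ae {S : Type*} [MeasurableSpace S]
    {μ : Measure S} {p : ℝ≥0∞} (hp : p ≠ 0) (hp' : p ≠ ⊤) {X : Type*} [NormedAddCommGroup X]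
    {f : ℕ → Lp X p μ} {g : Lp X p μ} (hnorm : Tendsto (fun n => ‖f n‖) atTop (nhds ‖g‖))
    (hae : ∀ᵐ s ∂μ, Tendsto (fun n => f n s) atTop (nhds (g s))) :
    Tendsto (fun n => ‖f n - g‖) atTop (nhds 0) := by
  have hr : 0 < p.toReal := ENNReal.toReal_pos hp hp'
  set r := p.toReal
  have hi : ∀ h : Lp X p μ, Integrable (fun s => ‖h s‖ ^ r) μ := fun h =>
    (Lp.memLp h).integrable_norm_rpow hp hp'
  have hi' : ∀ n, Integrable (fun s => ‖f n s - g s‖ ^ r) μ := fun n =>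
    ((Lp.memLp (f n)).sub (Lp.memLp g)).integrable_norm_rpow hp hp'
  have hle : ∀ n s, ‖f n s - g s‖ ^ r ≤ 2 ^ r * (‖f n s‖ ^ r + ‖g s‖ ^ r) := fun n s => by
    have h1 : ‖f n s - g s‖ ≤ 2 * max ‖f n s‖ ‖g s‖ := by
      linarith [norm_sub_le (f n s) (g s), le_max_left ‖f n s‖ ‖g s‖,
        le_max_right ‖f n s‖ ‖g s‖]
    refine (Real.rpow_le_rpow (norm_nonneg _) h1 hr.le).trans ?_
    rw [Real.mul_rpow two_pos.le (by positivity)]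
    gcongr
    have h2 : 0 ≤ ‖f n s‖ ^ r := by positivity
    have h3 : 0 ≤ ‖g s‖ ^ r := by positivity
    rcases max_choice ‖f n s‖ ‖g s‖ with h | h <;> rw [h] <;> linarith
  have hint : ∀ h : Lp X p μ, ∫ s, 2 ^ r * (‖h s‖ ^ r + ‖g s‖ ^ r) ∂μ =
      2 ^ r * (‖h‖ ^ r + ‖g‖ ^ r) := fun h => by
    rw [integral_const_mul, integral_add (hi h) (hi g), Lp.norm_rpow_eq_integral hp hp',
      Lp.norm_rpow_eq_integral hp hp']
  have key : Tendsto (fun n => ∫ s, ‖f n s - g s‖ ^ r ∂μ) atTop (nhds 0) := by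
    refine tendsto_integral_zero_of_le_of_tendsto_ae hi'
      (fun n => ((hi (f n)).add (hi g)).const_mul (2 ^ r))
      (((hi g).add (hi g)).const_mul (2 ^ r)) (fun n s => by positivity) hle
      (fun s => by simp only [Pi.add_apply]; positivity) ?_ ?_ ?_
    · filter_upwards [hae] with s hs
      have := (hs.sub_const (g s)).norm.rpow_const (p := r) (Or.inr hr.le)
      simpa [hr.ne'] using this
    · filter_upwards [hae] with s hs
      exact ((hs.norm.rpow_const (Or.inr hr.le)).add_const _).const_mul _
    · simp only [Pi.add_apply, hint]
      exact ((hnorm.rpow_const (Or.inr hr.le)).add_const _).const_mul _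
  have key' := key.rpow_const (p := r⁻¹) (Or.inr (inv_nonneg.2 hr.le))
  rw [Real.zero_rpow (inv_ne_zero hr.ne')] at key'
  refine key'.congr fun n => ?_
  have h1 : ∫ s, ‖f n s - g s‖ ^ r ∂μ = ∫ s, ‖(f n - g : Lp X p μ) s‖ ^ r ∂μ :=
    integral_congr_ae <| by
      filter_upwards [Lp.coeFn_sub (f n) g] with s hs
      rw [hs, Pi.sub_apply]
  rw [h1, ← Lp.norm_rpow_eq_integral hp hp']
  exact Real.rpow_rpow_inv ENNReal.toReal_nonneg hr.ne'

/-- If `μ` is σ-finite, `1 < p < ∞` and `X` is a strongly convex real Banach space, then the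
Lebesgue–Bochner space `L^p(μ, X)` is strongly convex. -/
theorem Lp_stronglyConvex {S : Type*} [MeasurableSpace S] (μ : Measure S) [SigmaFinite μ]
    (p : ℝ≥0∞) [Fact (1 ≤ p)] (hp : 1 < p) (hp' : p ≠ ⊤)
    (X : Type*) [NormedAddCommGroup X] [NormedSpace ℝ X] [CompleteSpace X]
    (hX : StronglyConvexSpace X) :
    StronglyConvexSpace (Lp X p μ) := by
  intro fs hfs f hf Φ hΦ hΦf hlim
  have hr : 1 < p.toReal := (ENNReal.toReal_lt_toReal ENNReal.one_ne_top hp').2 hp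
  have hp0 : p ≠ 0 := (zero_lt_one.trans hp).ne'
  set r := p.toReal with hrdef
  obtain ⟨g, hg, hgΦ, hφ⟩ := Lp.exists_ae_continuousLinearMap_of_norming hp hp' hΦ.le hf hΦf
    (fun i : Option ℕ => i.elim f fs)
  rw [← hrdef] at hφ
  have hi : ∀ h : Lp X p μ, Integrable (fun s => ‖h s‖ ^ r) μ := fun h =>
    (Lp.memLp h).integrable_norm_rpow hp0 hp'
  have hint : ∀ h : Lp X p μ, ‖h‖ = 1 → ∫ s, ‖h s‖ ^ r ∂μ = 1 := fun h hh => by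
    rw [← Lp.norm_rpow_eq_integral hp0 hp', hh, Real.one_rpow]
  have hpow : ∀ a : ℝ, 0 ≤ a → a ^ (r - 1) * a = a ^ r := fun a ha => by
    rw [← Real.rpow_add_one' ha (by linarith), sub_add_cancel]
  have hgf : ∀ᵐ s ∂μ, g none s = ‖f s‖ ^ r := by
    have hle : g none ≤ᵐ[μ] fun s => ‖f s‖ ^ r := by
      filter_upwards [hφ] with s ⟨φ, hφ1, hφ2⟩
      rw [← hφ2, ← hpow _ (norm_nonneg _)]
      exact (le_abs_self _).trans (φ.le_of_opNorm_le hφ1 _)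
    refine (integral_eq_iff_of_ae_le (hg none) (hi f) hle).1 ?_
    rw [hgΦ, hint f hf]
    exact hΦf
  let T : ℕ → S → ℝ := fun n s => ‖fs n s‖ ^ r + (r - 1) * ‖f s‖ ^ r - r * g (some n) s
  have hT : ∀ n, Integrable (T n) μ := fun n =>
    ((hi (fs n)).add ((hi f).const_mul _)).sub ((hg _).const_mul _)
  have hgle : ∀ᵐ s ∂μ, ∀ n, g (some n) s ≤ ‖f s‖ ^ (r - 1) * ‖fs n s‖ := by
    filter_upwards [hφ] with s ⟨φ, hφ1, hφ2⟩ n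
    rw [← hφ2]
    exact (le_abs_self _).trans (φ.le_of_opNorm_le hφ1 _)
  have hTle : ∀ᵐ s ∂μ, ∀ n,
      ‖fs n s‖ ^ r + (r - 1) * ‖f s‖ ^ r - r * (‖f s‖ ^ (r - 1) * ‖fs n s‖) ≤ T n s := by
    filter_upwards [hgle] with s hs n
    have := mul_le_mul_of_nonneg_left (hs n) (by linarith : 0 ≤ r)
    simp only [T]
    linarith
  have hT0 : ∀ n, 0 ≤ᵐ[μ] T n := fun n => by
    filter_upwards [hTle] with s hs
    have := mul_rpow_sub_one_mul_le hr (norm_nonneg (f s)) (norm_nonneg (fs n s))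
    exact le_trans (by simp only [Pi.zero_apply]; linarith) (hs n)
  have hTint : Tendsto (fun n => ∫ s, T n s ∂μ) atTop (nhds 0) := by
    have h := (hlim.const_mul r).const_sub r
    rw [mul_one, sub_self] at h
    refine h.congr fun n => ?_
    simp only [T]
    rw [integral_sub (by exact (hi (fs n)).add ((hi f).const_mul _)) ((hg _).const_mul _),
      integral_add (hi (fs n)) ((hi f).const_mul _), integral_const_mul, integral_const_mul,
      hint _ (hfs n), hint f hf, hgΦ]
    simp only [Option.elim_some]
    ring
  refine tendsto_of_subseq_tendsto fun ns hns => ?_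
  obtain ⟨ms, -, hms⟩ := exists_seq_tendsto_ae_of_tendsto_integral_zero (fun n => hT (ns n))
    (fun n => hT0 (ns n)) (hTint.comp hns)
  refine ⟨ms, Lp.tendsto_norm_sub_zero_of_tendsto_ae hp0 hp' (by simp [hfs, hf]) ?_⟩
  filter_upwards [hφ, hgf, hTle, hms] with s ⟨φ, hφ1, hφ2⟩ hs1 hs2 hs3
  have hnorm : Tendsto (fun n => ‖fs (ns (ms n)) s‖) atTop (nhds ‖f s‖) := by
    refine tendsto_of_young_defect_tendsto_zero hr (norm_nonneg _) (fun n => norm_nonneg _) ?_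
    refine squeeze_zero (fun n => ?_) (fun n => hs2 (ns (ms n))) hs3
    have := mul_rpow_sub_one_mul_le hr (norm_nonneg (f s)) (norm_nonneg (fs (ns (ms n)) s))
    linarith
  rcases eq_or_ne (f s) 0 with h0 | h0
  · rw [h0, norm_zero] at hnorm
    rw [h0]
    exact tendsto_zero_iff_norm_tendsto_zero.2 hnorm
  have hw : 0 < ‖f s‖ ^ (r - 1) := Real.rpow_pos_of_pos (norm_pos_iff.2 h0) _
  have hglim : Tendsto (fun n => g (some (ns (ms n))) s) atTop (nhds (‖f s‖ ^ r)) := by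
    have h1 := ((hnorm.rpow_const (p := r) (Or.inr (by linarith))).add_const
      ((r - 1) * ‖f s‖ ^ r)).sub hs3
    have h2 := h1.const_mul r⁻¹
    have hr0 : r ≠ 0 := by linarith
    have h3 : r⁻¹ * (‖f s‖ ^ r + (r - 1) * ‖f s‖ ^ r - 0) = ‖f s‖ ^ r := by
      field_simp
      ring
    rw [h3] at h2
    refine h2.congr fun n => ?_
    simp only [T]
    field_simp
    ring
  refine hX.tendsto_of_norm_le h0 (φ := (‖f s‖ ^ (r - 1))⁻¹ • φ) ?_ ?_ hnorm ?_
  · rw [norm_smul, norm_inv, Real.norm_of_nonneg hw.le]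
    exact inv_mul_le_one_of_le₀ hφ1 hw.le
  · have : φ (f s) = ‖f s‖ ^ r := (hφ2 none).trans hs1
    rw [smul_apply, this, ← hpow _ (norm_nonneg _), smul_eq_mul,
      inv_mul_cancel_left₀ hw.ne']
  · have h1 := hglim.const_mul (‖f s‖ ^ (r - 1))⁻¹
    rw [← hpow _ (norm_nonneg _), inv_mul_cancel_left₀ hw.ne'] at h1
    refine h1.congr fun n => ?_
    rw [← hφ2]
    rfl
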